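/- arXiv:2011.06763 — 8 statements merged into one kernel-verified Lean document; each statement's English description precedes it below -/
import Mathlib

section
/- Let C : 2^A → 2^A be a path-independent choice function on a finite set A, and let A1, A2 ⊆ A. If C(A1 ∪ {a}) = C(A1) for every a ∈ A2 \ A1, then C(A1 ∪ A2) = C(A1). -/
/-- Let `C : 2^A → 2^A` be a path-independent choice function on a
finite set `A` (`C S ⊆ S` for all `S`, and `C (S ∪ T) = C (C S ∪ T)` for all `S, T`),
and let `A1, A2 ⊆ A`. If `C (A1 ∪ {a}) = C A1` for every `a ∈ A2 \ A1`,
then `C (A1 ∪ A2) = C A1`. -/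
theorem stmt_2 {A : Type*} [Fintype A] [DecidableEq A]
    (C : Finset A → Finset A)
    (hchoice : ∀ S, C S ⊆ S)
    (hpi : ∀ S T, C (S ∪ T) = C (C S ∪ T))
    (A1 A2 : Finset A)
    (h : ∀ a ∈ A2 \ A1, C (insert a A1) = C A1) :
    C (A1 ∪ A2) = C A1 := by
  have absorb : ∀ a ∈ A2, C (A1 ∪ {a}) = C A1 := by
    intro a ha
    by_cases ha1 : a ∈ A1
    · rw [Finset.union_eq_left.mpr (Finset.singleton_subset_iff.mpr ha1)]
    · rw [Finset.union_comm, ← Finset.insert_eq]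
      exact h a (Finset.mem_sdiff.mpr ⟨ha, ha1⟩)
  clear h
  induction A2 using Finset.induction_on with
  | empty => rw [Finset.union_empty]
  | insert a s _ ih =>
    have hs : C (A1 ∪ s) = C A1 := ih fun b hb => absorb b (Finset.mem_insert_of_mem hb)
    calc C (A1 ∪ insert a s) = C ((A1 ∪ s) ∪ {a}) := by
          rw [Finset.insert_eq, Finset.union_comm {a} s, Finset.union_assoc]
      _ = C (A1 ∪ {a}) := by rw [hpi, hs, ← hpi]
      _ = C A1 := absorb a (Finset.mem_insert_self a s)
end

section
/- Let C : 2^A → 2^A be a path-independent choice function on a finite set A, and let A1, A2 ⊆ A. If a ∉ C(A1 ∪ {a}) for every a ∈ A2 \ A1, then C(A1 ∪ A2) = C(A1). -/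
/-- Path-independence implies consistency. -/
theorem choice_eq_of_subset_of_subset {A : Type*} [DecidableEq A] {C : Finset A → Finset A}
    (hpi : ∀ S T, C (S ∪ T) = C (C S ∪ T)) {S T : Finset A} (hCT : C S ⊆ T) (hTS : T ⊆ S) :
    C S = C T := by
  have := hpi S T
  rwa [Finset.union_eq_left.2 hTS, Finset.union_eq_right.2 hCT] at this

/-- Elements that individually do not affect the choice from `S` do not affect it jointly. -/
theorem choice_union_eq_of_forall_insert {A : Type*} [DecidableEq A] {C : Finset A → Finset A}
    (hpi : ∀ S T, C (S ∪ T) = C (C S ∪ T)) {S T : Finset A}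
    (h : ∀ a ∈ T, C (insert a S) = C S) : C (S ∪ T) = C S := by
  induction T using Finset.induction_on with
  | empty => simp
  | insert a T _ ih =>
    rw [Finset.union_insert, ← Finset.insert_union, hpi, h a (Finset.mem_insert_self a T), ← hpi]
    exact ih fun b hb => h b (Finset.mem_insert_of_mem hb)

/-- Let `C : 2^A → 2^A` be a path-independent choice function on a
finite set `A`, and let `A1, A2 ⊆ A`. If `a ∉ C (A1 ∪ {a})` for every `a ∈ A2 \ A1`,
then `C (A1 ∪ A2) = C A1`. -/
theorem stmt_3 {A : Type*} [Fintype A] [DecidableEq A]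
    (C : Finset A → Finset A)
    (hchoice : ∀ S, C S ⊆ S)
    (hpi : ∀ S T, C (S ∪ T) = C (C S ∪ T))
    (A1 A2 : Finset A)
    (h : ∀ a ∈ A2 \ A1, a ∉ C (insert a A1)) :
    C (A1 ∪ A2) = C A1 := by
  refine choice_union_eq_of_forall_insert hpi fun a ha => ?_
  by_cases ha1 : a ∈ A1
  · rw [Finset.insert_eq_of_mem ha1]
  · exact choice_eq_of_subset_of_subset hpi
      ((Finset.subset_insert_iff_of_notMem (h a (Finset.mem_sdiff.2 ⟨ha, ha1⟩))).1 (hchoice _))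
      (Finset.subset_insert a A1)
end

section
/- Let C : 2^A → 2^A be a path-independent choice function on a finite set A, let A1, A2 ⊆ A, and let a ∈ A. If C(A1 ∪ A2) = A1 and a ∈ C(A1 ∪ {a}), then a ∈ C(A2 ∪ {a}). -/
/-- Let `C : 2^A → 2^A` be a path-independent choice function on a
finite set `A`, let `A1, A2 ⊆ A` and `a ∈ A`. If `C (A1 ∪ A2) = A1` and
`a ∈ C (A1 ∪ {a})`, then `a ∈ C (A2 ∪ {a})`. -/
theorem stmt_4 {A : Type*} [Fintype A] [DecidableEq A]
    (C : Finset A → Finset A)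
    (hchoice : ∀ S, C S ⊆ S)
    (hpi : ∀ S T, C (S ∪ T) = C (C S ∪ T))
    (A1 A2 : Finset A) (a : A)
    (h1 : C (A1 ∪ A2) = A1)
    (h2 : a ∈ C (insert a A1)) :
    a ∈ C (insert a A2) := by
  have hunion : C (insert a A2 ∪ A1.erase a) = C (insert a A1) := by
    have h := hpi (A1 ∪ A2) {a}
    rw [h1] at h
    have e1 : insert a A2 ∪ A1.erase a = A1 ∪ A2 ∪ {a} := by grind
    have e2 : insert a A1 = A1 ∪ {a} := by grind
    rw [e1, e2, h]
  rw [← hunion, hpi] at h2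
  rcases Finset.mem_union.mp (hchoice _ h2) with h | h
  · exact h
  · exact absurd h (Finset.notMem_erase a A1)
end

section
/- Let (H, ⊆) be a ring of sets over a finite base set B with minimal element H0. Then the map sending an upper set U of the poset (D(H), ⊒) to the set H0 ∪ ⋃_{K ∈ U} K is a bijection from the upper sets of (D(H), ⊒) onto H; moreover, for every upper set U one has χ^{H0 ∪ ⋃_{K∈U} K} = χ^{H0} + Σ_{K∈U} χ^K as vectors in ℝ^B, and the characteristic vectors {χ^K : K ∈ D(H)} are linearly independent in ℝ^B. -/
/-- `H(a)`: the intersection of all members of the ring of sets `H` containing `a`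
(all of `B` if no member contains `a`). -/
def minContaining {B : Type*} [Fintype B] [DecidableEq B]
    (H : Finset (Finset B)) (a : B) : Finset B :=
  Finset.univ.filter (fun b => ∀ Hm ∈ H, a ∈ Hm → b ∈ Hm)

/-- `K(Hm)`: the centers of `Hm`, i.e. the elements `a` of the maximal element `Hz`
with `H(a) = Hm`. -/
def centers {B : Type*} [Fintype B] [DecidableEq B]
    (H : Finset (Finset B)) (Hz : Finset B) (Hm : Finset B) : Finset B :=
  Hz.filter (fun a => minContaining H a = Hm)

/-- `D(H)`: the sets of centers of the irreducible elements of `H` other than the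
minimal element `H0`. -/
def Dset {B : Type*} [Fintype B] [DecidableEq B]
    (H : Finset (Finset B)) (Hz H0 : Finset B) : Finset (Finset B) :=
  (H.filter (fun Hm => Hm ≠ H0 ∧ ∃ a ∈ Hz, minContaining H a = Hm)).image (centers H Hz)

/-- `Hm` is an irreducible element of the ring of sets `H`. -/
def Irred {B : Type*} [Fintype B] [DecidableEq B]
    (H : Finset (Finset B)) (Hz : Finset B) (Hm : Finset B) : Prop :=
  Hm ∈ H ∧ ∃ a ∈ Hz, minContaining H a = Hm

/-- The partial order `⊒` on `D(H)`: `K1 ⊒ K2` iff `I(K1) ⊆ I(K2)`, where `I(K)` is the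
irreducible element whose set of centers is `K`. -/
def SqSupseteq {B : Type*} [Fintype B] [DecidableEq B]
    (H : Finset (Finset B)) (Hz : Finset B) (K1 K2 : Finset B) : Prop :=
  ∀ H1 H2 : Finset B, Irred H Hz H1 → Irred H Hz H2 →
    centers H Hz H1 = K1 → centers H Hz H2 = K2 → H1 ⊆ H2

/-- `U ⊆ D(H)` is an upper set of the poset `(D(H), ⊒)`. -/
def IsUpperOfD {B : Type*} [Fintype B] [DecidableEq B]
    (H : Finset (Finset B)) (Hz H0 : Finset B) (U : Finset (Finset B)) : Prop :=
  U ⊆ Dset H Hz H0 ∧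
    ∀ K1 ∈ Dset H Hz H0, ∀ K2 ∈ U, SqSupseteq H Hz K1 K2 → K1 ∈ U

/-- The characteristic vector of a finite set, as a vector in `ℝ^B`. -/
def charvec {B : Type*} [Fintype B] [DecidableEq B] (S : Finset B) : B → ℝ :=
  fun b => if b ∈ S then 1 else 0

section RingOfSets

theorem mem_union_sup_iff {B : Type*} [DecidableEq B] {H0 : Finset B}
    {U : Finset (Finset B)} {b : B} :
    b ∈ H0 ∪ U.sup id ↔ b ∈ H0 ∨ ∃ K ∈ U, b ∈ K := by
  simp [Finset.mem_sup]

variable {B : Type*} [Fintype B] [DecidableEq B] {H : Finset (Finset B)} {H0 Hz : Finset B}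

theorem mem_minContaining_self (a : B) : a ∈ minContaining H a := by
  simp [minContaining]

theorem minContaining_subset_iff {Hm : Finset B} (hHm : Hm ∈ H) {a : B} :
    minContaining H a ⊆ Hm ↔ a ∈ Hm := by
  refine ⟨fun h => h (mem_minContaining_self a), fun ha b hb => ?_⟩
  simp only [minContaining, Finset.mem_filter, Finset.mem_univ, true_and] at hb
  exact hb Hm hHm ha

theorem minContaining_mem (hcap : ∀ H1 ∈ H, ∀ H2 ∈ H, H1 ∩ H2 ∈ H) (hHz : Hz ∈ H)
    {a : B} (ha : a ∈ Hz) : minContaining H a ∈ H := by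
  have hne : (H.filter (a ∈ ·)).Nonempty := ⟨Hz, by simp [hHz, ha]⟩
  have hmem : (H.filter (a ∈ ·)).inf' hne id ∈ H :=
    Finset.inf'_mem (H : Set (Finset B)) hcap _ hne id fun i hi => (Finset.mem_filter.1 hi).1
  convert hmem using 1
  ext b
  rw [← Finset.singleton_subset_iff (s := Finset.inf' _ _ _), Finset.le_inf'_iff]
  simp [minContaining]

/-- A subset of `Hz` containing `H0` and closed under `a ↦ H(a)` belongs to the ring of sets. -/
theorem mem_of_minContaining_subset (hcup : ∀ H1 ∈ H, ∀ H2 ∈ H, H1 ∪ H2 ∈ H)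
    (hcap : ∀ H1 ∈ H, ∀ H2 ∈ H, H1 ∩ H2 ∈ H) (hH0 : H0 ∈ H) (hHz : Hz ∈ H)
    {T : Finset B} (hT : T ⊆ Hz) (h0 : H0 ⊆ T) (hclosed : ∀ a ∈ T, minContaining H a ⊆ T) :
    T ∈ H := by
  have key : ∀ S : Finset B, S ⊆ Hz → H0 ∪ S.biUnion (minContaining H) ∈ H := by
    intro S
    induction S using Finset.induction_on with
    | empty => simpa using hH0
    | insert a S _ ih =>
      intro hS
      rw [Finset.insert_subset_iff] at hS
      rw [Finset.biUnion_insert, Finset.union_left_comm]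
      exact hcup _ (minContaining_mem hcap hHz hS.1) _ (ih hS.2)
  have hTeq : H0 ∪ T.biUnion (minContaining H) = T := by
    refine Finset.Subset.antisymm (Finset.union_subset h0 (Finset.biUnion_subset.2 hclosed)) ?_
    exact fun a ha => Finset.mem_union_right _
      (Finset.mem_biUnion.2 ⟨a, ha, mem_minContaining_self a⟩)
  exact hTeq ▸ key T hT

theorem mem_centers_minContaining {a : B} (ha : a ∈ Hz) :
    a ∈ centers H Hz (minContaining H a) := by
  simp [centers, ha]

theorem minContaining_eq_of_mem_centers {Hm : Finset B} {a : B} (h : a ∈ centers H Hz Hm) :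
    minContaining H a = Hm :=
  (Finset.mem_filter.1 h).2

theorem centers_subset (Hm : Finset B) : centers H Hz Hm ⊆ Hm := fun a ha =>
  minContaining_eq_of_mem_centers ha ▸ mem_minContaining_self a

theorem minContaining_eq_iff (hcap : ∀ H1 ∈ H, ∀ H2 ∈ H, H1 ∩ H2 ∈ H) (hH0 : H0 ∈ H)
    (hH0min : ∀ Hm ∈ H, H0 ⊆ Hm) (hHz : Hz ∈ H) {a : B} (ha : a ∈ Hz) :
    minContaining H a = H0 ↔ a ∈ H0 := by
  rw [← minContaining_subset_iff hH0]
  exact ⟨fun h => h.subset, fun h => h.antisymm (hH0min _ (minContaining_mem hcap hHz ha))⟩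

theorem centers_minContaining_mem_Dset (hcap : ∀ H1 ∈ H, ∀ H2 ∈ H, H1 ∩ H2 ∈ H) (hH0 : H0 ∈ H)
    (hH0min : ∀ Hm ∈ H, H0 ⊆ Hm) (hHz : Hz ∈ H) {a : B} (ha : a ∈ Hz) (ha0 : a ∉ H0) :
    centers H Hz (minContaining H a) ∈ Dset H Hz H0 := by
  refine Finset.mem_image_of_mem _ (Finset.mem_filter.2
    ⟨minContaining_mem hcap hHz ha, ?_, a, ha, rfl⟩)
  rwa [Ne, minContaining_eq_iff hcap hH0 hH0min hHz ha]

theorem nonempty_of_mem_Dset {K : Finset B} (hK : K ∈ Dset H Hz H0) : K.Nonempty := by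
  simp only [Dset, Finset.mem_image, Finset.mem_filter] at hK
  obtain ⟨_, ⟨_, _, a, ha, rfl⟩, rfl⟩ := hK
  exact ⟨a, mem_centers_minContaining ha⟩

theorem eq_centers_of_mem {K : Finset B} (hK : K ∈ Dset H Hz H0) {b : B} (hb : b ∈ K) :
    K = centers H Hz (minContaining H b) := by
  simp only [Dset, Finset.mem_image, Finset.mem_filter] at hK
  obtain ⟨Hm, -, rfl⟩ := hK
  rw [minContaining_eq_of_mem_centers hb]

theorem subset_of_mem_Dset {K : Finset B} (hK : K ∈ Dset H Hz H0) : K ⊆ Hz := by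
  simp only [Dset, Finset.mem_image, Finset.mem_filter] at hK
  obtain ⟨Hm, -, rfl⟩ := hK
  exact Finset.filter_subset _ _

theorem notMem_of_mem_Dset (hcap : ∀ H1 ∈ H, ∀ H2 ∈ H, H1 ∩ H2 ∈ H) (hH0 : H0 ∈ H)
    (hH0min : ∀ Hm ∈ H, H0 ⊆ Hm) (hHz : Hz ∈ H) {K : Finset B} (hK : K ∈ Dset H Hz H0)
    {b : B} (hb : b ∈ K) : b ∉ H0 := by
  rw [← minContaining_eq_iff hcap hH0 hH0min hHz (subset_of_mem_Dset hK hb)]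
  simp only [Dset, Finset.mem_image, Finset.mem_filter] at hK
  obtain ⟨Hm, ⟨-, hne, -⟩, rfl⟩ := hK
  rwa [minContaining_eq_of_mem_centers hb]

theorem sqSupseteq_centers_iff (hcap : ∀ H1 ∈ H, ∀ H2 ∈ H, H1 ∩ H2 ∈ H) (hHz : Hz ∈ H)
    {a b : B} (ha : a ∈ Hz) (hb : b ∈ Hz) :
    SqSupseteq H Hz (centers H Hz (minContaining H a)) (centers H Hz (minContaining H b)) ↔
      minContaining H a ⊆ minContaining H b := by
  constructor
  · intro h
    exact h _ _ ⟨minContaining_mem hcap hHz ha, a, ha, rfl⟩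
      ⟨minContaining_mem hcap hHz hb, b, hb, rfl⟩ rfl rfl
  · intro h H1 H2 _ _ h1 h2
    have ha1 : a ∈ centers H Hz H1 := h1 ▸ mem_centers_minContaining ha
    have hb2 : b ∈ centers H Hz H2 := h2 ▸ mem_centers_minContaining hb
    rwa [← minContaining_eq_of_mem_centers ha1, ← minContaining_eq_of_mem_centers hb2]

theorem eq_of_mem_of_mem_Dset {K L : Finset B} (hK : K ∈ Dset H Hz H0) (hL : L ∈ Dset H Hz H0)
    {b : B} (hbK : b ∈ K) (hbL : b ∈ L) : K = L :=
  (eq_centers_of_mem hK hbK).trans (eq_centers_of_mem hL hbL).symm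

theorem union_sup_mem (hcup : ∀ H1 ∈ H, ∀ H2 ∈ H, H1 ∪ H2 ∈ H)
    (hcap : ∀ H1 ∈ H, ∀ H2 ∈ H, H1 ∩ H2 ∈ H) (hH0 : H0 ∈ H) (hH0min : ∀ Hm ∈ H, H0 ⊆ Hm)
    (hHz : Hz ∈ H) {U : Finset (Finset B)} (hU : IsUpperOfD H Hz H0 U) :
    H0 ∪ U.sup id ∈ H := by
  refine mem_of_minContaining_subset hcup hcap hH0 hHz ?_ Finset.subset_union_left ?_
  · exact Finset.union_subset (hH0min _ hHz)
      (Finset.sup_le fun K hK => subset_of_mem_Dset (hU.1 hK))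
  · intro a ha c hc
    rw [mem_union_sup_iff] at ha ⊢
    rcases ha with ha | ⟨K, hK, haK⟩
    · exact Or.inl ((minContaining_subset_iff hH0).2 ha hc)
    · by_cases hc0 : c ∈ H0
      · exact Or.inl hc0
      have haz := subset_of_mem_Dset (hU.1 hK) haK
      have hcz := (minContaining_subset_iff hHz).2 haz hc
      refine Or.inr ⟨_, hU.2 _ (centers_minContaining_mem_Dset hcap hH0 hH0min hHz hcz hc0) K hK ?_,
        mem_centers_minContaining hcz⟩
      rw [eq_centers_of_mem (hU.1 hK) haK, sqSupseteq_centers_iff hcap hHz hcz haz]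
      exact (minContaining_subset_iff (minContaining_mem hcap hHz haz)).2 hc

theorem subset_of_union_sup_eq (hcap : ∀ H1 ∈ H, ∀ H2 ∈ H, H1 ∩ H2 ∈ H) (hH0 : H0 ∈ H)
    (hH0min : ∀ Hm ∈ H, H0 ⊆ Hm) (hHz : Hz ∈ H) {U1 U2 : Finset (Finset B)}
    (hU1 : U1 ⊆ Dset H Hz H0) (hU2 : U2 ⊆ Dset H Hz H0)
    (h : H0 ∪ U1.sup id = H0 ∪ U2.sup id) : U1 ⊆ U2 := by
  intro K hK
  obtain ⟨b, hb⟩ := nonempty_of_mem_Dset (hU1 hK)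
  have hmem : b ∈ H0 ∪ U2.sup id := h ▸ mem_union_sup_iff.2 (Or.inr ⟨K, hK, hb⟩)
  obtain ⟨L, hL, hbL⟩ := (mem_union_sup_iff.1 hmem).resolve_left
    (notMem_of_mem_Dset hcap hH0 hH0min hHz (hU1 hK) hb)
  rwa [eq_of_mem_of_mem_Dset (hU1 hK) (hU2 hL) hb hbL]

theorem exists_isUpperOfD_union_sup_eq (hcap : ∀ H1 ∈ H, ∀ H2 ∈ H, H1 ∩ H2 ∈ H) (hH0 : H0 ∈ H)
    (hH0min : ∀ Hm ∈ H, H0 ⊆ Hm) (hHz : Hz ∈ H) (hHzmax : ∀ Hm ∈ H, Hm ⊆ Hz)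
    {Hm : Finset B} (hHm : Hm ∈ H) :
    ∃ U : Finset (Finset B), IsUpperOfD H Hz H0 U ∧ H0 ∪ U.sup id = Hm := by
  refine ⟨(Dset H Hz H0).filter (· ⊆ Hm), ⟨Finset.filter_subset _ _, ?_⟩, ?_⟩
  · intro K1 hK1 K2 hK2 hle
    rw [Finset.mem_filter] at hK2 ⊢
    refine ⟨hK1, ?_⟩
    obtain ⟨a, ha⟩ := nonempty_of_mem_Dset hK1
    obtain ⟨b, hb⟩ := nonempty_of_mem_Dset hK2.1
    rw [eq_centers_of_mem hK1 ha, eq_centers_of_mem hK2.1 hb, sqSupseteq_centers_iff hcap hHz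
      (subset_of_mem_Dset hK1 ha) (subset_of_mem_Dset hK2.1 hb)] at hle
    rw [eq_centers_of_mem hK1 ha]
    exact (centers_subset _).trans (hle.trans ((minContaining_subset_iff hHm).2 (hK2.2 hb)))
  · refine Finset.Subset.antisymm (Finset.union_subset (hH0min _ hHm)
      (Finset.sup_le fun K hK => (Finset.mem_filter.1 hK).2)) fun b hb => ?_
    rw [mem_union_sup_iff]
    by_cases hb0 : b ∈ H0
    · exact Or.inl hb0
    have hbz := hHzmax _ hHm hb
    exact Or.inr ⟨_, Finset.mem_filter.2
      ⟨centers_minContaining_mem_Dset hcap hH0 hH0min hHz hbz hb0,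
        (centers_subset _).trans ((minContaining_subset_iff hHm).2 hb)⟩,
      mem_centers_minContaining hbz⟩

theorem charvec_union_sup (hcap : ∀ H1 ∈ H, ∀ H2 ∈ H, H1 ∩ H2 ∈ H) (hH0 : H0 ∈ H)
    (hH0min : ∀ Hm ∈ H, H0 ⊆ Hm) (hHz : Hz ∈ H) {U : Finset (Finset B)}
    (hU : U ⊆ Dset H Hz H0) :
    charvec (H0 ∪ U.sup id) = charvec H0 + ∑ K ∈ U, charvec K := by
  ext b
  simp only [charvec, Pi.add_apply, Finset.sum_apply, mem_union_sup_iff]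
  by_cases h : ∃ K ∈ U, b ∈ K
  · obtain ⟨K, hK, hbK⟩ := h
    rw [Finset.sum_eq_single_of_mem K hK fun L hL hne =>
      if_neg fun hbL => hne (eq_of_mem_of_mem_Dset (hU hL) (hU hK) hbL hbK)]
    rw [if_pos (Or.inr ⟨K, hK, hbK⟩), if_pos hbK,
      if_neg (notMem_of_mem_Dset hcap hH0 hH0min hHz (hU hK) hbK), zero_add]
  · rw [Finset.sum_eq_zero fun K hK => if_neg fun hb => h ⟨K, hK, hb⟩]
    simp only [h, or_false, add_zero]

theorem linearIndependent_charvec_Dset :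
    LinearIndependent ℝ (fun K : (Dset H Hz H0 : Finset (Finset B)) =>
      charvec (K : Finset B)) := by
  rw [Fintype.linearIndependent_iff]
  intro g hg K
  obtain ⟨b, hb⟩ := nonempty_of_mem_Dset K.2
  have h := congrFun hg b
  simp only [Finset.sum_apply, Pi.smul_apply, charvec, smul_eq_mul, Pi.zero_apply] at h
  rw [Finset.sum_eq_single_of_mem K (Finset.mem_univ K) fun L _ hne => ?_, if_pos hb, mul_one] at h
  · exact h
  · rw [if_neg fun hbL => hne (Subtype.ext (eq_of_mem_of_mem_Dset L.2 K.2 hbL hb)), mul_zero]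

end RingOfSets

/-- Let `(H, ⊆)` be a ring of sets over a finite base set `B` with
minimal element `H0`. Then `U ↦ H0 ∪ ⋃_{K ∈ U} K` is a bijection from the upper sets of
`(D(H), ⊒)` onto `H`; moreover `χ^{H0 ∪ ⋃_{K ∈ U} K} = χ^{H0} + ∑_{K ∈ U} χ^K` for every
upper set `U`, and the vectors `{χ^K : K ∈ D(H)}` are linearly independent in `ℝ^B`. -/
theorem stmt_6 {B : Type*} [Fintype B] [DecidableEq B]
    (H : Finset (Finset B)) (hne : H.Nonempty)
    (hcup : ∀ H1 ∈ H, ∀ H2 ∈ H, H1 ∪ H2 ∈ H)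
    (hcap : ∀ H1 ∈ H, ∀ H2 ∈ H, H1 ∩ H2 ∈ H)
    (H0 Hz : Finset B)
    (hH0 : H0 ∈ H) (hH0min : ∀ Hm ∈ H, H0 ⊆ Hm)
    (hHz : Hz ∈ H) (hHzmax : ∀ Hm ∈ H, Hm ⊆ Hz) :
    (∀ U : Finset (Finset B), IsUpperOfD H Hz H0 U → H0 ∪ U.sup id ∈ H) ∧
    (∀ U1 U2 : Finset (Finset B), IsUpperOfD H Hz H0 U1 → IsUpperOfD H Hz H0 U2 →
      H0 ∪ U1.sup id = H0 ∪ U2.sup id → U1 = U2) ∧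
    (∀ Hm ∈ H, ∃ U : Finset (Finset B), IsUpperOfD H Hz H0 U ∧ H0 ∪ U.sup id = Hm) ∧
    (∀ U : Finset (Finset B), IsUpperOfD H Hz H0 U →
      charvec (H0 ∪ U.sup id) = charvec H0 + ∑ K ∈ U, charvec K) ∧
    LinearIndependent ℝ (fun K : (Dset H Hz H0 : Finset (Finset B)) =>
      charvec (K : Finset B)) := by
  exact ⟨fun U hU => union_sup_mem hcup hcap hH0 hH0min hHz hU,
    fun U1 U2 h1 h2 h =>
      (subset_of_union_sup_eq hcap hH0 hH0min hHz h1.1 h2.1 h).antisymm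
        (subset_of_union_sup_eq hcap hH0 hH0min hHz h2.1 h1.1 h.symm),
    fun Hm hHm => exists_isUpperOfD_union_sup_eq hcap hH0 hH0min hHz hHzmax hHm,
    fun U hU => charvec_union_sup hcap hH0 hH0min hHz hU.1,
    linearIndependent_charvec_Dset⟩
end

section
/- Let (H, ⊆) be a ring of sets over a finite base set B, and let H', H ∈ H with H' ⊆ H. If H \ H' ∈ D(H), then H' is an immediate predecessor of H in (H, ⊆), i.e., H' ⊊ H and there is no H'' ∈ H with H' ⊊ H'' ⊊ H. -/
/-- Let `(H, ⊆)` be a ring of sets over a finite base set `B`, and let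
`H', Hm ∈ H` with `H' ⊆ Hm`. If `Hm \ H' ∈ D(H)` then `H'` is an immediate predecessor
of `Hm` in `(H, ⊆)`: `H' ⊊ Hm` and there is no `H'' ∈ H` with `H' ⊊ H'' ⊊ Hm`. -/
theorem stmt_8 {B : Type*} [Fintype B] [DecidableEq B]
    (H : Finset (Finset B)) (hne : H.Nonempty)
    (hcup : ∀ H1 ∈ H, ∀ H2 ∈ H, H1 ∪ H2 ∈ H)
    (hcap : ∀ H1 ∈ H, ∀ H2 ∈ H, H1 ∩ H2 ∈ H)
    (H0 Hz : Finset B)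
    (hH0 : H0 ∈ H) (hH0min : ∀ Hm ∈ H, H0 ⊆ Hm)
    (hHz : Hz ∈ H) (hHzmax : ∀ Hm ∈ H, Hm ⊆ Hz)
    (H' Hm : Finset B) (hH' : H' ∈ H) (hHm : Hm ∈ H) (hsub : H' ⊆ Hm)
    (hd : Hm \ H' ∈ Dset H Hz H0) :
    H' ⊂ Hm ∧ ¬ ∃ H'' ∈ H, H' ⊂ H'' ∧ H'' ⊂ Hm := by
  obtain ⟨K, hK, hKd⟩ := Finset.mem_image.1 hd
  obtain ⟨-, -, a, haz, haK⟩ := Finset.mem_filter.1 hK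
  have hmin : ∀ x ∈ Hm \ H', minContaining H x = K := fun x hx =>
    (Finset.mem_filter.1 (hKd ▸ hx : x ∈ centers H Hz K)).2
  have ha : a ∈ Hm \ H' := hKd ▸ Finset.mem_filter.2 ⟨haz, haK⟩
  rw [Finset.mem_sdiff] at ha
  refine ⟨Finset.ssubset_iff_subset_ne.2 ⟨hsub, fun h => ha.2 (h ▸ ha.1)⟩, ?_⟩
  rintro ⟨H'', hH'', hlt, hlt'⟩
  obtain ⟨x, hx'', hx'⟩ := Finset.exists_of_ssubset hlt
  obtain ⟨y, hy, hy''⟩ := Finset.exists_of_ssubset hlt'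
  have hxd : x ∈ Hm \ H' := Finset.mem_sdiff.2 ⟨hlt'.subset hx'', hx'⟩
  have hyd : y ∈ Hm \ H' := Finset.mem_sdiff.2 ⟨hy, fun h => hy'' (hlt.subset h)⟩
  have hyx : y ∈ minContaining H x := by
    rw [hmin x hxd, ← hmin y hyd]
    simp [minContaining]
  exact hy'' ((Finset.mem_filter.1 hyx).2 H'' hH'' hx'')
end

section
/- In a matching market in which all choice functions are path-independent and cardinal monotone, the map μ ↦ P(μ) is injective on the set S of stable matchings, and for all μ1, μ2 ∈ S one has μ2 ⪰ μ1 if and only if P(μ2) ⊆ P(μ1). -/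
/-- A matching market: finite disjoint sets of firms `F` and workers `W`; each firm `f`
has a set `accF f ⊆ W` of acceptable workers and a choice function `Cf f` on subsets of
`accF f`; each worker `w` has a set `accW w ⊆ F` and a choice function `Cw w`, where
`f ∈ accW w ↔ w ∈ accF f`. -/
structure Market (F W : Type*) [Fintype F] [Fintype W] [DecidableEq F] [DecidableEq W] where
  accF : F → Finset W
  accW : W → Finset F
  compat : ∀ f w, f ∈ accW w ↔ w ∈ accF f
  Cf : F → Finset W → Finset W
  Cw : W → Finset F → Finset F
  CfSub : ∀ f S, Cf f S ⊆ S
  CwSub : ∀ w S, Cw w S ⊆ S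

namespace Market

variable {F W : Type*} [Fintype F] [Fintype W] [DecidableEq F] [DecidableEq W]

/-- The set `μ(w)` of firms matched to worker `w` under the matching `μ`. -/
def mw (M : Market F W) (μ : F → Finset W) (w : W) : Finset F :=
  Finset.univ.filter (fun f => w ∈ μ f)

/-- `μ` is a matching: each firm is matched to acceptable workers. -/
def IsMatching (M : Market F W) (μ : F → Finset W) : Prop :=
  ∀ f, μ f ⊆ M.accF f

/-- `μ` is individually rational. -/
def IndRational (M : Market F W) (μ : F → Finset W) : Prop :=
  (∀ f, M.Cf f (μ f) = μ f) ∧ (∀ w, M.Cw w (M.mw μ w) = M.mw μ w)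

/-- The acceptable pair `(f, w)` blocks `μ`. -/
def Blocks (M : Market F W) (μ : F → Finset W) (f : F) (w : W) : Prop :=
  w ∈ M.accF f ∧ w ∉ μ f ∧
    w ∈ M.Cf f (insert w (μ f)) ∧ f ∈ M.Cw w (insert f (M.mw μ w))

/-- `μ` is a stable matching. -/
def Stable (M : Market F W) (μ : F → Finset W) : Prop :=
  M.IsMatching μ ∧ M.IndRational μ ∧ ∀ f w, ¬ M.Blocks μ f w

/-- `Dom M μ2 μ1` is the partial order `μ2 ⪰ μ1` on stable matchings:
`C_f(μ2(f) ∪ μ1(f)) = μ2(f)` for every firm `f`. -/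
def Dom (M : Market F W) (μ2 μ1 : F → Finset W) : Prop :=
  ∀ f, M.Cf f (μ2 f ∪ μ1 f) = μ2 f

/-- `φ(f)`: the set of stable partners of firm `f`. -/
def phi (M : Market F W) (f : F) : Set W :=
  {w | ∃ μ, M.Stable μ ∧ w ∈ μ f}

/-- `P_f(μ) = {w ∈ φ(f) : w ∈ C_f(μ(f) ∪ {w})}`. -/
def Pf (M : Market F W) (μ : F → Finset W) (f : F) : Set W :=
  {w | w ∈ M.phi f ∧ w ∈ M.Cf f (insert w (μ f))}

/-- The P-set `P(μ) = {(f, w) : f ∈ F, w ∈ P_f(μ)}`. -/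
def Pset (M : Market F W) (μ : F → Finset W) : Set (F × W) :=
  {p | p.2 ∈ M.Pf μ p.1}

/-- All choice functions of the market are path-independent and cardinal monotone
(on their domains). -/
def PathIndepCM (M : Market F W) : Prop :=
  (∀ f, ∀ S ⊆ M.accF f, ∀ T ⊆ M.accF f, M.Cf f (S ∪ T) = M.Cf f (M.Cf f S ∪ T)) ∧
  (∀ f, ∀ S T : Finset W, S ⊆ T → T ⊆ M.accF f → (M.Cf f S).card ≤ (M.Cf f T).card) ∧
  (∀ w, ∀ S ⊆ M.accW w, ∀ T ⊆ M.accW w, M.Cw w (S ∪ T) = M.Cw w (M.Cw w S ∪ T)) ∧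
  (∀ w, ∀ S T : Finset F, S ⊆ T → T ⊆ M.accW w → (M.Cw w S).card ≤ (M.Cw w T).card)

end Market

section ChoiceFunction

variable {α : Type*} [DecidableEq α] {C : Finset α → Finset α} {A : Finset α}

/-- A path-independent choice function is substitutable. -/
theorem mem_choice_of_subset
    (hPI : ∀ S ⊆ A, ∀ T ⊆ A, C (S ∪ T) = C (C S ∪ T)) (hsub : ∀ S, C S ⊆ S)
    {S T : Finset α} {x : α} (hST : S ⊆ T) (hT : T ⊆ A) (hxS : x ∈ S) (hxT : x ∈ C T) :
    x ∈ C S := by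
  have hunion : C T = C (C S ∪ T \ S) := by
    rw [← hPI S (hST.trans hT) (T \ S) (Finset.sdiff_subset.trans hT),
      Finset.union_sdiff_of_subset hST]
  rw [hunion] at hxT
  simpa [hxS] using hsub _ hxT

/-- If `S` is chosen from itself and no single element of `T` outside `S` would be added to it,
then `S` is chosen from `S ∪ T`. -/
theorem choice_union_eq_left
    (hPI : ∀ S ⊆ A, ∀ T ⊆ A, C (S ∪ T) = C (C S ∪ T)) (hsub : ∀ S, C S ⊆ S)
    {S T : Finset α} (hS : S ⊆ A) (hT : T ⊆ A) (hCS : C S = S)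
    (hrej : ∀ x ∈ T, x ∉ S → x ∉ C (insert x S)) : C (S ∪ T) = S := by
  have hST : S ∪ T ⊆ A := Finset.union_subset hS hT
  have hle : C (S ∪ T) ⊆ S := by
    intro x hx
    by_contra hxS
    have hxT : x ∈ T := (Finset.mem_union.1 (hsub _ hx)).resolve_left hxS
    refine hrej x hxT hxS (mem_choice_of_subset hPI hsub ?_ hST (Finset.mem_insert_self x S) hx)
    exact Finset.insert_subset (Finset.mem_union_right S hxT) Finset.subset_union_left
  have hidem := hPI (S ∪ T) hST S hS
  rwa [Finset.union_eq_right.2 hle, hCS,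
    Finset.union_eq_left.2 (Finset.subset_union_left : S ⊆ S ∪ T)] at hidem

end ChoiceFunction

namespace Market

variable {F W : Type*} [Fintype F] [Fintype W] [DecidableEq F] [DecidableEq W]
  {M : Market F W} {μ μ1 μ2 : F → Finset W}

theorem mem_mw {f : F} {w : W} : f ∈ M.mw μ w ↔ w ∈ μ f := by
  simp [mw]

theorem IsMatching.mw_subset (hμ : M.IsMatching μ) (w : W) : M.mw μ w ⊆ M.accW w :=
  fun f hf => (M.compat f w).2 (hμ f (mem_mw.1 hf))

theorem Stable.mem_Pset (hμ : M.Stable μ) {f : F} {w : W} (hw : w ∈ μ f) :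
    (f, w) ∈ M.Pset μ := by
  refine ⟨⟨μ, hμ, hw⟩, ?_⟩
  simpa [Finset.insert_eq_self.2 hw, hμ.2.1.1 f] using hw

theorem Dom.antisymm (h21 : M.Dom μ2 μ1) (h12 : M.Dom μ1 μ2) : μ1 = μ2 := by
  funext f
  rw [← h12 f, Finset.union_comm, h21 f]

theorem Dom.Pset_subset (h : M.PathIndepCM) (h1 : M.Stable μ1) (h2 : M.Stable μ2)
    (hdom : M.Dom μ2 μ1) : M.Pset μ2 ⊆ M.Pset μ1 := by
  rintro ⟨f, w⟩ ⟨hφ, hw⟩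
  refine ⟨hφ, ?_⟩
  obtain ⟨ν, hν, hwν⟩ := hφ
  have hacc : {w} ⊆ M.accF f := Finset.singleton_subset_iff.2 (hν.1 f hwν)
  have hunion : μ2 f ∪ μ1 f ⊆ M.accF f := Finset.union_subset (h2.1 f) (h1.1 f)
  have hall : w ∈ M.Cf f ((μ2 f ∪ μ1 f) ∪ {w}) := by
    rw [h.1 f _ hunion _ hacc, hdom f, Finset.union_comm, ← Finset.insert_eq]
    exact hw
  refine mem_choice_of_subset (h.1 f) (M.CfSub f) ?_ (Finset.union_subset hunion hacc)
    (Finset.mem_insert_self w (μ1 f)) hall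
  intro x hx
  simp only [Finset.mem_insert, Finset.mem_union, Finset.mem_singleton] at hx ⊢
  tauto

/-- Workers choose their partners under `μ1` over those under `μ2` when `P(μ2) ⊆ P(μ1)`. -/
theorem Cw_mw_union_eq_of_Pset_subset (h : M.PathIndepCM) (h1 : M.Stable μ1) (h2 : M.Stable μ2)
    (hP : M.Pset μ2 ⊆ M.Pset μ1) (w : W) :
    M.Cw w (M.mw μ1 w ∪ M.mw μ2 w) = M.mw μ1 w := by
  refine choice_union_eq_left (h.2.2.1 w) (M.CwSub w) (h1.1.mw_subset w) (h2.1.mw_subset w)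
    (h1.2.1.2 w) fun f hf2 hf1 hf => ?_
  rw [mem_mw] at hf1 hf2
  exact h1.2.2 f w ⟨h2.1 f hf2, hf1, (hP (h2.mem_Pset hf2)).2, hf⟩

theorem Dom.of_Pset_subset (h : M.PathIndepCM) (h1 : M.Stable μ1) (h2 : M.Stable μ2)
    (hP : M.Pset μ2 ⊆ M.Pset μ1) : M.Dom μ2 μ1 := by
  intro f
  refine choice_union_eq_left (h.1 f) (M.CfSub f) (h2.1 f) (h1.1 f) (h2.2.1.1 f)
    fun w hw1 hw2 hw => h2.2.2 f w ⟨h1.1 f hw1, hw2, hw, ?_⟩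
  have hf : f ∈ M.mw μ1 w := mem_mw.2 hw1
  refine mem_choice_of_subset (h.2.2.1 w) (M.CwSub w) (T := M.mw μ1 w ∪ M.mw μ2 w)
    (Finset.insert_subset (Finset.mem_union_left _ hf) Finset.subset_union_right)
    (Finset.union_subset (h1.1.mw_subset w) (h2.1.mw_subset w)) (Finset.mem_insert_self _ _) ?_
  rwa [Cw_mw_union_eq_of_Pset_subset h h1 h2 hP w]

end Market

/-- In a matching market in which all choice functions are
path-independent and cardinal monotone, the map `μ ↦ P(μ)` is injective on the set of
stable matchings, and for stable `μ1, μ2`: `μ2 ⪰ μ1 ↔ P(μ2) ⊆ P(μ1)`. -/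
theorem stmt_9 {F W : Type*} [Fintype F] [Fintype W] [DecidableEq F] [DecidableEq W]
    (M : Market F W) (h : M.PathIndepCM) :
    (∀ μ1 μ2 : F → Finset W, M.Stable μ1 → M.Stable μ2 →
      M.Pset μ1 = M.Pset μ2 → μ1 = μ2) ∧
    (∀ μ1 μ2 : F → Finset W, M.Stable μ1 → M.Stable μ2 →
      (M.Dom μ2 μ1 ↔ M.Pset μ2 ⊆ M.Pset μ1)) := by
  exact ⟨fun μ1 μ2 h1 h2 hP =>
      (Market.Dom.of_Pset_subset h h1 h2 hP.ge).antisymm (Market.Dom.of_Pset_subset h h2 h1 hP.le),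
    fun μ1 μ2 h1 h2 => ⟨Market.Dom.Pset_subset h h1 h2, Market.Dom.of_Pset_subset h h1 h2⟩⟩
end

section
/- Let X be a finite set, w ∈ X, and Y = X \ {w}. Let 𝒜 be an antichain of (2^Y, ⊆), i.e., no two distinct members of 𝒜 are comparable under inclusion. Define T := {B ⊆ X : A ∪ {w} ⊆ B for some A ∈ 𝒜}, and define C : 2^X → 2^X by C(S) = S \ {w} if S ∈ T, and C(S) = S otherwise. Then C is a choice function (C(S) ⊆ S for all S) that is consistent and cardinal monotone. -/
/-- Let `X` be a finite set, `w ∈ X`, `Y = X \ {w}`, and let `𝒜` be an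
antichain of `(2^Y, ⊆)`. Define `T := {B ⊆ X : A ∪ {w} ⊆ B for some A ∈ 𝒜}` and
`C : 2^X → 2^X` by `C S = S \ {w}` if `S ∈ T` and `C S = S` otherwise. Then `C` is a
choice function (`C S ⊆ S` for all `S`) that is consistent and cardinal monotone. -/
theorem stmt_11 {X : Type*} [Fintype X] [DecidableEq X] (w : X)
    (𝒜 : Finset (Finset X))
    (hsubY : ∀ A ∈ 𝒜, w ∉ A)  -- members of 𝒜 are subsets of Y = X \ {w}
    (hanti : ∀ A ∈ 𝒜, ∀ B ∈ 𝒜, A ≠ B → ¬ A ⊆ B ∧ ¬ B ⊆ A)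
    (C : Finset X → Finset X)
    (hC : ∀ S, C S = if ∃ A ∈ 𝒜, insert w A ⊆ S then S.erase w else S) :
    (∀ S, C S ⊆ S) ∧
    (∀ S T, C S ⊆ T → T ⊆ S → C S = C T) ∧
    (∀ S T, S ⊆ T → (C S).card ≤ (C T).card) := by
  have hsub : ∀ S, C S ⊆ S := fun S => by
    rw [hC]
    split_ifs
    · exact Finset.erase_subset w S
    · exact Finset.Subset.refl S
  refine ⟨hsub, fun S T hST hTS => ?_, fun S T hST => ?_⟩
  · by_cases hS : ∃ A ∈ 𝒜, insert w A ⊆ S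
    · have hCS : C S = S.erase w := by rw [hC, if_pos hS]
      rw [hCS] at hST
      by_cases hw : w ∈ T
      · have hle : S ⊆ T := fun x hx => by
          by_cases hxw : x = w
          · exact hxw ▸ hw
          · exact hST (Finset.mem_erase.2 ⟨hxw, hx⟩)
        rw [hle.antisymm hTS]
      · have hT : ¬ ∃ A ∈ 𝒜, insert w A ⊆ T := fun ⟨A, _, hA⟩ =>
          hw (hA (Finset.mem_insert_self w A))
        rw [hCS, hC T, if_neg hT]
        exact hST.antisymm (Finset.subset_erase.2 ⟨hTS, hw⟩)
    · have hCS : C S = S := by rw [hC, if_neg hS]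
      rw [hCS] at hST
      rw [hST.antisymm hTS]
  · by_cases hT : ∃ A ∈ 𝒜, insert w A ⊆ T
    · rcases hST.eq_or_ssubset with rfl | hlt
      · exact le_rfl
      · have hCT : C T = T.erase w := by rw [hC, if_pos hT]
        rw [hCT]
        have hcard := Finset.card_lt_card hlt
        have hle := Finset.card_le_card (hsub S)
        have herase := Finset.pred_card_le_card_erase (s := T) (a := w)
        omega
    · have hCT : C T = T := by rw [hC, if_neg hT]
      rw [hCT]
      exact Finset.card_le_card ((hsub S).trans hST)
end

section
/- In a matching market in which all choice functions are path-independent and cardinal monotone, let μ1 and μ2 be stable matchings with μ2 ⪰ μ1, and suppose w ∈ P_f(μ1) \ P_f(μ2) for some firm f. Then there exists a stable matching μ̄ with μ2 ⪰ μ̄ ⪰ μ1 and w ∈ μ̄(f). -/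
open Finset

/-- `C` restricts to a path-independent, cardinal monotone choice function on subsets of `E`. -/
structure IsChoiceOn {α : Type*} [DecidableEq α] (E : Finset α) (C : Finset α → Finset α) :
    Prop where
  sub : ∀ S, C S ⊆ S
  pathIndep : ∀ S ⊆ E, ∀ T ⊆ E, C (S ∪ T) = C (C S ∪ T)
  cardMono : ∀ S T, S ⊆ T → T ⊆ E → (C S).card ≤ (C T).card

namespace IsChoiceOn

variable {α : Type*} [DecidableEq α] {E : Finset α} {C : Finset α → Finset α}

lemma mem_of_subset (hC : IsChoiceOn E C) {S T : Finset α} (hST : S ⊆ T) (hT : T ⊆ E) {e : α}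
    (he : e ∈ C T) (heS : e ∈ S) : e ∈ C S := by
  have key := hC.pathIndep S (hST.trans hT) (T \ S) (sdiff_subset.trans hT)
  rw [union_sdiff_of_subset hST] at key
  rw [key] at he
  have := hC.sub _ he
  simp only [mem_union, mem_sdiff] at this
  tauto

lemma eq_of_subset_of_subset (hC : IsChoiceOn E C) {S T : Finset α} (hT : T ⊆ E)
    (h1 : C T ⊆ S) (h2 : S ⊆ T) : C S = C T := by
  have key := hC.pathIndep T hT S (h2.trans hT)
  rw [union_eq_left.2 h2, union_eq_right.2 h1] at key
  exact key.symm

lemma pathIndep_right (hC : IsChoiceOn E C) {S T : Finset α} (hS : S ⊆ E) (hT : T ⊆ E) :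
    C (S ∪ T) = C (S ∪ C T) := by
  rw [union_comm, hC.pathIndep T hT S hS, union_comm]

lemma eq_of_rejects (hC : IsChoiceOn E C) {μ X : Finset α} (hX : X ⊆ E) (hμX : μ ⊆ X)
    (hμ : C μ = μ) (hrej : ∀ e ∈ X, e ∉ μ → e ∉ C (insert e μ)) : C X = μ := by
  have hsub : C X ⊆ μ := by
    intro e he
    by_contra hne
    have heX := hC.sub _ he
    exact hrej e heX hne
      (hC.mem_of_subset (insert_subset heX hμX) hX he (mem_insert_self _ _))
  rw [← hC.eq_of_subset_of_subset hX hsub hμX, hμ]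

end IsChoiceOn

/-- Pairwise stability of a set `μ ⊆ E` for the two aggregate choice functions `C` and `D`. -/
structure StableSet {α : Type*} [DecidableEq α] (E : Finset α) (C D : Finset α → Finset α)
    (μ : Finset α) : Prop where
  sub : μ ⊆ E
  rat_left : C μ = μ
  rat_right : D μ = μ
  no_block : ∀ e ∈ E, e ∉ μ → ¬ (e ∈ C (insert e μ) ∧ e ∈ D (insert e μ))

/-- A stable pair in the sense of Fleiner: `X` and `Y` cover `E`, and both choice functions
select the common part `μ = X ∩ Y`. -/
structure StablePair {α : Type*} [DecidableEq α] (E : Finset α) (C D : Finset α → Finset α)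
    (X Y μ : Finset α) : Prop where
  cover : X ∪ Y = E
  inter : X ∩ Y = μ
  left : C X = μ
  right : D Y = μ

namespace StablePair

variable {α : Type*} [DecidableEq α] {E : Finset α} {C D : Finset α → Finset α}
  {X Y X' Y' μ ν : Finset α}

lemma swap (h : StablePair E C D X Y μ) : StablePair E D C Y X μ :=
  ⟨by rw [union_comm, h.cover], by rw [inter_comm, h.inter], h.right, h.left⟩

lemma left_subset (h : StablePair E C D X Y μ) : X ⊆ E := h.cover ▸ subset_union_left

lemma right_subset (h : StablePair E C D X Y μ) : Y ⊆ E := h.cover ▸ subset_union_right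

lemma subset_left (h : StablePair E C D X Y μ) : μ ⊆ X := h.inter ▸ inter_subset_left

lemma subset_right (h : StablePair E C D X Y μ) : μ ⊆ Y := h.inter ▸ inter_subset_right

lemma stableSet (hC : IsChoiceOn E C) (hD : IsChoiceOn E D) (h : StablePair E C D X Y μ) :
    StableSet E C D μ where
  sub := h.subset_left.trans h.left_subset
  rat_left := (hC.eq_of_subset_of_subset h.left_subset h.left.le h.subset_left).trans h.left
  rat_right := (hD.eq_of_subset_of_subset h.right_subset h.right.le h.subset_right).trans h.right
  no_block := by
    rintro e he hne ⟨heC, heD⟩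
    rw [← h.cover, mem_union] at he
    rcases he with he | he
    · rw [hC.eq_of_subset_of_subset h.left_subset
        (h.left.le.trans (subset_insert _ _)) (insert_subset he h.subset_left), h.left] at heC
      exact hne heC
    · rw [hD.eq_of_subset_of_subset h.right_subset
        (h.right.le.trans (subset_insert _ _)) (insert_subset he h.subset_right), h.right] at heD
      exact hne heD

lemma choice_union (hC : IsChoiceOn E C) (h : StablePair E C D X Y μ)
    (h' : StablePair E C D X' Y' ν) : C (X ∪ X') = C (μ ∪ ν) := by
  rw [hC.pathIndep X h.left_subset X' h'.left_subset, h.left,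
    hC.pathIndep_right (h.subset_left.trans h.left_subset) h'.left_subset, h'.left]

lemma choice_union_subset (hC : IsChoiceOn E C) (h : StablePair E C D X Y μ)
    (h' : StablePair E C D X' Y' ν) : C (X ∪ X') ⊆ (μ ∩ Y') ∪ (ν ∩ Y) := by
  have hU := union_subset h.left_subset h'.left_subset
  intro e he
  have heE := hU (hC.sub _ he)
  have hX : e ∈ X → e ∈ μ := fun heX => h.left ▸ hC.mem_of_subset subset_union_left hU he heX
  have hX' : e ∈ X' → e ∈ ν :=
    fun heX => h'.left ▸ hC.mem_of_subset subset_union_right hU he heX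
  have hXY : e ∈ X ∨ e ∈ Y := by rwa [← mem_union, h.cover]
  have hXY' : e ∈ X' ∨ e ∈ Y' := by rwa [← mem_union, h'.cover]
  have hμ : e ∈ μ → e ∈ Y := fun he => h.subset_right he
  have hν : e ∈ ν → e ∈ Y' := fun he => h'.subset_right he
  have := mem_union.1 (hC.sub _ he)
  simp only [mem_union, mem_inter]
  tauto

lemma subset_choice_inter (hD : IsChoiceOn E D) (h : StablePair E C D X Y μ)
    (h' : StablePair E C D X' Y' ν) : (μ ∩ Y') ∪ (ν ∩ Y) ⊆ D (Y ∩ Y') := by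
  intro e he
  simp only [mem_union, mem_inter] at he
  rcases he with ⟨h1, h2⟩ | ⟨h1, h2⟩
  · exact hD.mem_of_subset inter_subset_left h.right_subset (h.right.symm ▸ h1)
      (mem_inter.2 ⟨h.subset_right h1, h2⟩)
  · exact hD.mem_of_subset inter_subset_right h'.right_subset (h'.right.symm ▸ h1)
      (mem_inter.2 ⟨h2, h'.subset_right h1⟩)

lemma choice_eq_choice (hC : IsChoiceOn E C) (hD : IsChoiceOn E D)
    (h : StablePair E C D X Y μ) (h' : StablePair E C D X' Y' ν) :
    C (X ∪ X') = D (Y ∩ Y') := by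
  refine eq_of_subset_of_card_le
    ((choice_union_subset hC h h').trans (subset_choice_inter hD h h')) ?_
  calc (D (Y ∩ Y')).card ≤ (D Y).card := hD.cardMono _ _ inter_subset_left h.right_subset
    _ = (C X).card := by rw [h.left, h.right]
    _ ≤ _ := hC.cardMono _ _ subset_union_left (union_subset h.left_subset h'.left_subset)

lemma choice_union_eq (hC : IsChoiceOn E C) (hD : IsChoiceOn E D)
    (h : StablePair E C D X Y μ) (h' : StablePair E C D X' Y' ν) :
    C (μ ∪ ν) = (μ ∩ Y') ∪ (ν ∩ Y) := by
  rw [← choice_union hC h h']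
  refine (choice_union_subset hC h h').antisymm ?_
  rw [choice_eq_choice hC hD h h']
  exact subset_choice_inter hD h h'

lemma join (hC : IsChoiceOn E C) (hD : IsChoiceOn E D)
    (h : StablePair E C D X Y μ) (h' : StablePair E C D X' Y' ν) :
    StablePair E C D (X ∪ X') (Y ∩ Y') (C (μ ∪ ν)) where
  cover := by
    ext e
    have h1 : e ∈ X ∨ e ∈ Y ↔ e ∈ E := by rw [← mem_union, h.cover]
    have h2 : e ∈ X' ∨ e ∈ Y' ↔ e ∈ E := by rw [← mem_union, h'.cover]
    simp only [mem_union, mem_inter]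
    tauto
  inter := by
    rw [choice_union_eq hC hD h h', ← h.inter, ← h'.inter]
    ext e
    simp only [mem_union, mem_inter]
    tauto
  left := choice_union hC h h'
  right := by rw [← choice_eq_choice hC hD h h', choice_union hC h h']

end StablePair

namespace StableSet

variable {α : Type*} [DecidableEq α] {E : Finset α} {C D : Finset α → Finset α}
  {μ ν κ : Finset α}

lemma swap (h : StableSet E C D μ) : StableSet E D C μ :=
  ⟨h.sub, h.rat_right, h.rat_left, fun e he hne hb => h.no_block e he hne hb.symm⟩

lemma exists_stablePair (hC : IsChoiceOn E C) (hD : IsChoiceOn E D) (h : StableSet E C D μ) :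
    ∃ X Y, StablePair E C D X Y μ := by
  have hμE := h.sub
  refine ⟨E.filter fun e => e ∈ μ ∨ e ∉ C (insert e μ),
    E.filter fun e => e ∈ μ ∨ e ∈ C (insert e μ), ?_, ?_, ?_, ?_⟩
  · ext e
    simp only [mem_union, mem_filter]
    tauto
  · ext e
    have := @hμE e
    simp only [mem_inter, mem_filter]
    tauto
  · refine hC.eq_of_rejects (filter_subset _ _)
      (fun e he => mem_filter.2 ⟨hμE he, Or.inl he⟩) h.rat_left fun e he hne => ?_
    have := (mem_filter.1 he).2
    tauto
  · refine hD.eq_of_rejects (filter_subset _ _)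
      (fun e he => mem_filter.2 ⟨hμE he, Or.inl he⟩) h.rat_right fun e he hne => ?_
    have := (mem_filter.1 he).2
    have := h.no_block e (mem_filter.1 he).1 hne
    tauto

lemma join (hC : IsChoiceOn E C) (hD : IsChoiceOn E D) (hμ : StableSet E C D μ)
    (hν : StableSet E C D ν) : StableSet E C D (C (μ ∪ ν)) := by
  obtain ⟨X, Y, h⟩ := hμ.exists_stablePair hC hD
  obtain ⟨X', Y', h'⟩ := hν.exists_stablePair hC hD
  exact (h.join hC hD h').stableSet hC hD

lemma meet (hC : IsChoiceOn E C) (hD : IsChoiceOn E D) (hμ : StableSet E C D μ)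
    (hν : StableSet E C D ν) : StableSet E C D (D (μ ∪ ν)) :=
  (hμ.swap.join hD hC hν.swap).swap

lemma mem_join_or_mem_meet (hC : IsChoiceOn E C) (hD : IsChoiceOn E D)
    (hμ : StableSet E C D μ) (hν : StableSet E C D ν) {e : α} (he : e ∈ μ) :
    e ∈ C (μ ∪ ν) ∨ e ∈ D (μ ∪ ν) := by
  obtain ⟨X, Y, h⟩ := hμ.exists_stablePair hC hD
  obtain ⟨X', Y', h'⟩ := hν.exists_stablePair hC hD
  rw [h.choice_union_eq hC hD h', h.swap.choice_union_eq hD hC h'.swap]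
  have := hμ.sub he
  rw [← h'.cover, mem_union] at this
  simp only [mem_union, mem_inter]
  tauto

lemma choice_union_meet (hC : IsChoiceOn E C) (hD : IsChoiceOn E D)
    (hμ : StableSet E C D μ) (hν : StableSet E C D ν) : C (μ ∪ D (μ ∪ ν)) = μ := by
  obtain ⟨X, Y, h⟩ := hμ.exists_stablePair hC hD
  obtain ⟨X', Y', h'⟩ := hν.exists_stablePair hC hD
  have hN : D (μ ∪ ν) ⊆ X :=
    (h.swap.join hD hC h'.swap).swap.subset_left.trans inter_subset_left
  have := hC.pathIndep X h.left_subset _ (hN.trans h.left_subset)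
  rwa [union_eq_left.2 hN, h.left, eq_comm] at this

/-- The preferences of the two sides over stable sets are opposed. -/
lemma polarity (hC : IsChoiceOn E C) (hD : IsChoiceOn E D)
    (hμ : StableSet E C D μ) (hκ : StableSet E C D κ) (hdom : C (μ ∪ κ) = μ) :
    D (μ ∪ κ) = κ := by
  obtain ⟨X, Y, h⟩ := hμ.exists_stablePair hC hD
  obtain ⟨X', Y', h'⟩ := hκ.exists_stablePair hC hD
  symm
  refine eq_of_subset_of_card_le ?_ ?_
  · intro e he
    rw [h.swap.choice_union_eq hD hC h'.swap]
    by_cases heμ : e ∈ μ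
    · exact mem_union_left _ (mem_inter.2 ⟨heμ, h'.subset_left he⟩)
    · refine mem_union_right _ (mem_inter.2 ⟨he, ?_⟩)
      by_contra heX
      have heY : e ∈ Y := by
        have := hκ.sub he
        rw [← h.cover, mem_union] at this
        tauto
      apply heμ
      rw [← hdom, h.choice_union_eq hC hD h']
      exact mem_union_right _ (mem_inter.2 ⟨he, heY⟩)
  · rw [← h.swap.choice_union hD h'.swap, h.swap.choice_eq_choice hD hC h'.swap]
    calc (C (X ∩ X')).card ≤ (C X').card := hC.cardMono _ _ inter_subset_right h'.left_subset
      _ = κ.card := by rw [h'.left]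

lemma meet_dominates (hC : IsChoiceOn E C) (hD : IsChoiceOn E D)
    (hμ : StableSet E C D μ) (hν : StableSet E C D ν) (hκ : StableSet E C D κ)
    (hμκ : C (μ ∪ κ) = μ) (hνκ : C (ν ∪ κ) = ν) :
    C (D (μ ∪ ν) ∪ κ) = D (μ ∪ ν) := by
  have key : D (D (μ ∪ ν) ∪ κ) = κ := by
    rw [← hD.pathIndep _ (union_subset hμ.sub hν.sub) _ hκ.sub, union_assoc,
      hD.pathIndep_right hμ.sub (union_subset hν.sub hκ.sub), hν.polarity hC hD hκ hνκ,
      hμ.polarity hC hD hκ hμκ]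
  rw [union_comm] at key ⊢
  exact hκ.swap.polarity hD hC (hμ.meet hC hD hν).swap key

/-- An element of some stable set that `C` accepts on top of `μ` but rejects on top of the
`C`-preferred `ν` belongs to a stable set between `μ` and `ν`. -/
theorem exists_between (hC : IsChoiceOn E C) (hD : IsChoiceOn E D)
    (hμ : StableSet E C D μ) (hν : StableSet E C D ν) (hκ : StableSet E C D κ)
    (hdom : C (ν ∪ μ) = ν) {e : α} (heκ : e ∈ κ) (heμ : e ∈ C (insert e μ))
    (heν : e ∉ C (insert e ν)) :
    ∃ ρ, StableSet E C D ρ ∧ C (ν ∪ ρ) = ν ∧ C (ρ ∪ μ) = ρ ∧ e ∈ ρ := by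
  by_cases hmem : e ∈ μ
  · exact ⟨μ, hμ, hdom, by rw [union_self, hμ.rat_left], hmem⟩
  have hJ := hμ.join hC hD hκ
  have heJ : e ∈ C (μ ∪ κ) := by
    rw [union_comm]
    refine (hκ.mem_join_or_mem_meet hC hD hμ heκ).resolve_right fun heN => hmem ?_
    rw [union_comm] at heN
    have hN := hμ.choice_union_meet hC hD hκ
    have hNE := union_subset hμ.sub (hμ.meet hC hD hκ).sub
    rwa [hC.eq_of_subset_of_subset hNE (hN.le.trans (subset_insert _ _))
      (insert_subset (mem_union_right _ heN) subset_union_left), hN] at heμ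
  have hJμ : C (C (μ ∪ κ) ∪ μ) = C (μ ∪ κ) := by
    rw [← hC.pathIndep _ (union_subset hμ.sub hκ.sub) _ hμ.sub,
      union_eq_left.2 subset_union_left]
  refine ⟨D (ν ∪ C (μ ∪ κ)), hν.meet hC hD hJ, hν.choice_union_meet hC hD hJ,
    meet_dominates hC hD hν hJ hμ hdom hJμ, ?_⟩
  rw [union_comm]
  refine (hJ.mem_join_or_mem_meet hC hD hν heJ).resolve_left fun he => heν ?_
  exact hC.mem_of_subset (insert_subset (mem_union_left _ heJ) subset_union_right)
    (union_subset hJ.sub hν.sub) he (mem_insert_self _ _)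

end StableSet

section Aggregate

variable {α ι β : Type*} [Fintype β] [DecidableEq α]

/-- The partners of agent `i` in the set `X` of pairs. -/
def pairFiber (φ : α ≃ ι × β) (X : Finset α) (i : ι) : Finset β :=
  univ.filter fun b => φ.symm (i, b) ∈ X

variable {φ : α ≃ ι × β}

lemma pairFiber_mono {X Y : Finset α} (h : X ⊆ Y) (i : ι) :
    pairFiber φ X i ⊆ pairFiber φ Y i := by
  intro b hb
  simp only [pairFiber, mem_filter_univ] at hb ⊢
  exact h hb

lemma subset_of_pairFiber_subset {X Y : Finset α}
    (h : ∀ i, pairFiber φ X i ⊆ pairFiber φ Y i) : X ⊆ Y := by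
  intro a ha
  have := @h (φ a).1 (φ a).2
  simp only [pairFiber, mem_filter_univ, Prod.mk.eta, Equiv.symm_apply_apply] at this
  exact this ha

lemma eq_of_pairFiber_eq {X Y : Finset α} (h : ∀ i, pairFiber φ X i = pairFiber φ Y i) : X = Y :=
  (subset_of_pairFiber_subset fun i => (h i).le).antisymm
    (subset_of_pairFiber_subset fun i => (h i).ge)

lemma card_eq_sum_card_pairFiber [Fintype ι] (φ : α ≃ ι × β) (X : Finset α) :
    X.card = ∑ i, (pairFiber φ X i).card := by
  rw [← card_sigma]
  refine card_bij' (fun a _ => ⟨(φ a).1, (φ a).2⟩) (fun p _ => φ.symm (p.1, p.2)) ?_ ?_ ?_ ?_ <;>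
    simp [pairFiber]

variable [DecidableEq β]

lemma pairFiber_union (X Y : Finset α) (i : ι) :
    pairFiber φ (X ∪ Y) i = pairFiber φ X i ∪ pairFiber φ Y i := by
  ext b
  simp [pairFiber]

lemma pairFiber_insert (a : α) (X : Finset α) :
    pairFiber φ (insert a X) (φ a).1 = insert (φ a).2 (pairFiber φ X (φ a).1) := by
  ext b
  simp [pairFiber, Equiv.symm_apply_eq, Prod.ext_iff]

variable [Fintype α]

/-- The set of pairs obtained from a family of sets of partners. -/
def pairsOf (φ : α ≃ ι × β) (s : ι → Finset β) : Finset α :=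
  univ.filter fun a => (φ a).2 ∈ s (φ a).1

/-- The aggregate choice function of one side of the market. -/
def aggregateChoice (φ : α ≃ ι × β) (c : ι → Finset β → Finset β) (X : Finset α) : Finset α :=
  pairsOf φ fun i => c i (pairFiber φ X i)

lemma pairFiber_pairsOf (s : ι → Finset β) (i : ι) : pairFiber φ (pairsOf φ s) i = s i := by
  ext b
  simp [pairFiber, pairsOf]

lemma pairFiber_aggregateChoice (c : ι → Finset β → Finset β) (X : Finset α) (i : ι) :
    pairFiber φ (aggregateChoice φ c X) i = c i (pairFiber φ X i) :=
  pairFiber_pairsOf _ i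

lemma mem_aggregateChoice_insert {c : ι → Finset β → Finset β} {X : Finset α} {a : α} :
    a ∈ aggregateChoice φ c (insert a X) ↔
      (φ a).2 ∈ c (φ a).1 (insert (φ a).2 (pairFiber φ X (φ a).1)) := by
  simp [aggregateChoice, pairsOf, pairFiber_insert]

lemma isChoiceOn_aggregateChoice [Fintype ι] {c : ι → Finset β → Finset β} {acc : ι → Finset β}
    {E : Finset α} (hE : ∀ i, pairFiber φ E i = acc i) (hsub : ∀ i S, c i S ⊆ S)
    (hpi : ∀ i, ∀ S ⊆ acc i, ∀ T ⊆ acc i, c i (S ∪ T) = c i (c i S ∪ T))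
    (hcm : ∀ i, ∀ S T : Finset β, S ⊆ T → T ⊆ acc i → (c i S).card ≤ (c i T).card) :
    IsChoiceOn E (aggregateChoice φ c) where
  sub S := subset_of_pairFiber_subset (φ := φ) fun i => by
    rw [pairFiber_aggregateChoice]
    exact hsub i _
  pathIndep S hS T hT := eq_of_pairFiber_eq (φ := φ) fun i => by
    simp only [pairFiber_aggregateChoice, pairFiber_union]
    exact hpi i _ (hE i ▸ pairFiber_mono hS i) _ (hE i ▸ pairFiber_mono hT i)
  cardMono S T hST hT := by
    rw [card_eq_sum_card_pairFiber φ, card_eq_sum_card_pairFiber φ (aggregateChoice φ c T)]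
    refine sum_le_sum fun i _ => ?_
    simp only [pairFiber_aggregateChoice]
    exact hcm i _ _ (pairFiber_mono hST i) (hE i ▸ pairFiber_mono hT i)

end Aggregate

namespace Market

variable {F W : Type*} [Fintype F] [Fintype W] [DecidableEq F] [DecidableEq W]

/-- The set of pairs matched by `μ`. -/
def edges (μ : F → Finset W) : Finset (F × W) := pairsOf (Equiv.refl _) μ

/-- The aggregate choice function of the firms. -/
def firmChoice (M : Market F W) : Finset (F × W) → Finset (F × W) :=
  aggregateChoice (Equiv.refl _) M.Cf

/-- The aggregate choice function of the workers. -/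
def workerChoice (M : Market F W) : Finset (F × W) → Finset (F × W) :=
  aggregateChoice (Equiv.prodComm F W) M.Cw

lemma mem_edges {μ : F → Finset W} {p : F × W} : p ∈ edges μ ↔ p.2 ∈ μ p.1 := by
  rw [edges, pairsOf, mem_filter_univ]
  rfl

lemma pairFiber_edges (μ : F → Finset W) (f : F) :
    pairFiber (Equiv.refl _) (edges μ) f = μ f :=
  pairFiber_pairsOf μ f

lemma pairFiber_prodComm_edges (M : Market F W) (μ : F → Finset W) (w : W) :
    pairFiber (Equiv.prodComm F W) (edges μ) w = M.mw μ w := by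
  ext f
  simp [pairFiber, mem_edges, mw]

lemma edges_pairFiber (X : Finset (F × W)) : edges (pairFiber (Equiv.refl _) X) = X := by
  ext p
  rw [mem_edges, pairFiber, mem_filter_univ]
  rfl

lemma isChoiceOn_firmChoice {M : Market F W} (h : M.PathIndepCM) :
    IsChoiceOn (edges M.accF) M.firmChoice :=
  isChoiceOn_aggregateChoice (pairFiber_edges _) M.CfSub h.1 h.2.1

lemma isChoiceOn_workerChoice {M : Market F W} (h : M.PathIndepCM) :
    IsChoiceOn (edges M.accF) M.workerChoice := by
  refine isChoiceOn_aggregateChoice (fun w => ?_) M.CwSub h.2.2.1 h.2.2.2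
  ext f
  simp [pairFiber, mem_edges, M.compat]

lemma firmChoice_eq_edges_iff {M : Market F W} {X : Finset (F × W)} {μ : F → Finset W} :
    M.firmChoice X = edges μ ↔ ∀ f, M.Cf f (pairFiber (Equiv.refl _) X f) = μ f := by
  constructor
  · intro h f
    rw [← pairFiber_edges μ f, ← h]
    exact (pairFiber_aggregateChoice _ _ _).symm
  · intro h
    refine eq_of_pairFiber_eq (φ := Equiv.refl _) fun f => ?_
    rw [pairFiber_edges, ← h f]
    exact pairFiber_aggregateChoice _ _ _

lemma workerChoice_edges_eq_iff {M : Market F W} {μ : F → Finset W} :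
    M.workerChoice (edges μ) = edges μ ↔ ∀ w, M.Cw w (M.mw μ w) = M.mw μ w := by
  constructor
  · intro h w
    rw [← pairFiber_prodComm_edges]
    conv_rhs => rw [← h]
    exact (pairFiber_aggregateChoice _ _ _).symm
  · intro h
    refine eq_of_pairFiber_eq (φ := Equiv.prodComm F W) fun w => ?_
    rw [workerChoice, pairFiber_aggregateChoice, pairFiber_prodComm_edges, h w]

lemma mem_firmChoice_insert_edges {M : Market F W} {μ : F → Finset W} {f : F} {w : W} :
    (f, w) ∈ M.firmChoice (insert (f, w) (edges μ)) ↔ w ∈ M.Cf f (insert w (μ f)) := by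
  rw [firmChoice, mem_aggregateChoice_insert, pairFiber_edges]
  rfl

lemma mem_workerChoice_insert_edges {M : Market F W} {μ : F → Finset W} {f : F} {w : W} :
    (f, w) ∈ M.workerChoice (insert (f, w) (edges μ)) ↔
      f ∈ M.Cw w (insert f (M.mw μ w)) := by
  rw [workerChoice, mem_aggregateChoice_insert, pairFiber_prodComm_edges]
  rfl

lemma stable_iff {M : Market F W} {μ : F → Finset W} :
    M.Stable μ ↔ StableSet (edges M.accF) M.firmChoice M.workerChoice (edges μ) := by
  have hmatch : M.IsMatching μ ↔ edges μ ⊆ edges M.accF :=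
    ⟨fun h p hp => mem_edges.2 (h p.1 (mem_edges.1 hp)),
      fun h f w hw => mem_edges.1 (@h (f, w) (mem_edges.2 hw))⟩
  have hblock : (∀ f w, ¬ M.Blocks μ f w) ↔ ∀ e ∈ edges M.accF, e ∉ edges μ →
      ¬ (e ∈ M.firmChoice (insert e (edges μ)) ∧ e ∈ M.workerChoice (insert e (edges μ))) := by
    simp only [Prod.forall, mem_firmChoice_insert_edges, mem_workerChoice_insert_edges,
      mem_edges, Blocks, not_and]
  have hfirm : M.firmChoice (edges μ) = edges μ ↔ ∀ f, M.Cf f (μ f) = μ f := by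
    simp only [firmChoice_eq_edges_iff, pairFiber_edges]
  rw [Stable, IndRational, hmatch, hblock, ← hfirm, ← workerChoice_edges_eq_iff]
  exact ⟨fun h => ⟨h.1, h.2.1.1, h.2.1.2, h.2.2⟩, fun h => ⟨h.1, ⟨h.2, h.3⟩, h.4⟩⟩

lemma dom_iff {M : Market F W} {μ ν : F → Finset W} :
    M.Dom μ ν ↔ M.firmChoice (edges μ ∪ edges ν) = edges μ := by
  simp only [firmChoice_eq_edges_iff, pairFiber_union, pairFiber_edges, Dom]

end Market

/-- In a matching market in which all choice functions are
path-independent and cardinal monotone, if `μ1, μ2` are stable with `μ2 ⪰ μ1` and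
`w ∈ P_f(μ1) \ P_f(μ2)` for some firm `f`, then there is a stable matching `μ̄` with
`μ2 ⪰ μ̄ ⪰ μ1` and `w ∈ μ̄(f)`. -/
theorem stmt_13 {F W : Type*} [Fintype F] [Fintype W] [DecidableEq F] [DecidableEq W]
    (M : Market F W) (h : M.PathIndepCM)
    (μ1 μ2 : F → Finset W) (h1 : M.Stable μ1) (h2 : M.Stable μ2)
    (hdom : M.Dom μ2 μ1)
    (f : F) (w : W) (hw : w ∈ M.Pf μ1 f \ M.Pf μ2 f) :
    ∃ μbar : F → Finset W, M.Stable μbar ∧ M.Dom μ2 μbar ∧ M.Dom μbar μ1 ∧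
      w ∈ μbar f := by
  obtain ⟨⟨⟨ν, hν, hwν⟩, hw1⟩, hw2⟩ := hw
  have hw2' : w ∉ M.Cf f (insert w (μ2 f)) := fun hmem => hw2 ⟨⟨ν, hν, hwν⟩, hmem⟩
  obtain ⟨ρ, hρ, h2ρ, hρ1, hmem⟩ := StableSet.exists_between
    (Market.isChoiceOn_firmChoice h) (Market.isChoiceOn_workerChoice h)
    (Market.stable_iff.1 h1) (Market.stable_iff.1 h2) (Market.stable_iff.1 hν)
    (Market.dom_iff.1 hdom) (e := (f, w)) (Market.mem_edges.2 hwν)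
    (Market.mem_firmChoice_insert_edges.2 hw1)
    (fun hmem => hw2' (Market.mem_firmChoice_insert_edges.1 hmem))
  rw [← Market.edges_pairFiber ρ] at hρ h2ρ hρ1 hmem
  exact ⟨_, Market.stable_iff.2 hρ, Market.dom_iff.2 h2ρ, Market.dom_iff.2 hρ1,
    Market.mem_edges.1 hmem⟩
end
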